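/- arXiv:2006.16997 — 7 statements merged into one kernel-verified Lean document; each statement's English description precedes it below -/
import Mathlib

section
/- Under the stated assumptions, for every compact set K ⊆ ℝ, the supremum over c ∈ K of |F̂_N(c) − F(c)| converges to 0 in probability as N → ∞. That is, the empirical distribution function of the demeaned residuals of the control units converges in probability to the common cdf F, uniformly on compact subsets of the support, even though the W_i may be cross-sectionally dependent. -/
open MeasureTheory ProbabilityTheory Filter

/-- If `F` is continuous and `K` is compact, then a monotone function `G` that is close to `F` at
finitely many points is, after a small translation, uniformly close to `F` on `K`. -/
lemma IsCompact.exists_finset_forall_monotone_abs_sub_le {K : Set ℝ} (hK : IsCompact K)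
    {F : ℝ → ℝ} (hF : Continuous F) {ε : ℝ} (hε : 0 < ε) :
    ∃ (t : Finset ℝ) (δ : ℝ → ℝ), (∀ c, 0 < δ c) ∧ ∀ (G : ℝ → ℝ) (w : ℝ), Monotone G →
      (∀ c ∈ t, |w| < δ c ∧ |G (c + 2 * δ c) - F (c + 2 * δ c)| < ε ∧
        |G (c - 2 * δ c) - F (c - 2 * δ c)| < ε) →
      ∀ x ∈ K, |G (x + w) - F x| ≤ 3 * ε := by
  have hδ : ∀ c, ∃ δ > 0, ∀ x, |x - c| ≤ 2 * δ → |F x - F c| < ε := fun c ↦ by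
    obtain ⟨d, hd, h⟩ := Metric.continuous_iff.1 hF c ε hε
    refine ⟨d / 3, by positivity, fun x hx ↦ h x ?_⟩
    rw [Real.dist_eq]
    linarith
  choose δ hδ0 hδF using hδ
  obtain ⟨t, -, ht⟩ := hK.elim_nhds_subcover (fun c ↦ Metric.ball c (δ c))
    fun c _ ↦ Metric.ball_mem_nhds c (hδ0 c)
  refine ⟨t, δ, hδ0, fun G w hG h x hx ↦ ?_⟩
  obtain ⟨c, hct, hxc⟩ := Set.mem_iUnion₂.1 (ht hx)
  obtain ⟨hw, hup, hlo⟩ := h c hct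
  have hpos := hδ0 c
  rw [Metric.mem_ball, Real.dist_eq] at hxc
  have hFx := hδF c x (by linarith)
  have hFup := hδF c (c + 2 * δ c) (by rw [add_sub_cancel_left, abs_of_pos (by linarith)])
  have hFlo := hδF c (c - 2 * δ c)
    (by rw [sub_sub_cancel_left, abs_neg, abs_of_pos (by linarith)])
  rw [abs_lt] at hw hup hlo hxc hFx hFup hFlo
  have hGup : G (x + w) ≤ G (c + 2 * δ c) := hG (by linarith)
  have hGlo : G (c - 2 * δ c) ≤ G (x + w) := hG (by linarith)
  rw [abs_le]
  constructor <;> linarith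

lemma monotone_inv_mul_sum_ite_le {ι : Type*} (s : Finset ι) (f : ι → ℝ) (n : ℕ) :
    Monotone fun c : ℝ ↦ (n : ℝ)⁻¹ * ∑ i ∈ s, (if f i ≤ c then (1 : ℝ) else 0) := by
  intro a b hab
  dsimp only
  gcongr with i
  split_ifs with h₁ h₂
  · rfl
  · exact absurd (h₁.trans hab) h₂
  · exact zero_le_one
  · rfl

/-- If monotone random functions `G n` converge pointwise in probability to a continuous `F` and
random translations `w n` converge to `0` in probability, then the translates of `G n` by `w n`
converge in probability to `F`, uniformly on compact sets. -/
theorem tendstoInMeasure_iSup_abs_translate_sub {Ω ι : Type*} [MeasurableSpace Ω]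
    {P : Measure Ω} {l : Filter ι} {F : ℝ → ℝ} (hF : Continuous F)
    {G : ι → Ω → ℝ → ℝ} (hmono : ∀ n ω, Monotone (G n ω)) {w : ι → Ω → ℝ}
    (hw : TendstoInMeasure P w l fun _ ↦ (0 : ℝ))
    (hG : ∀ c, TendstoInMeasure P (fun n ω ↦ G n ω c) l fun _ ↦ F c)
    {K : Set ℝ} (hK : IsCompact K) :
    TendstoInMeasure P (fun n ω ↦ ⨆ c ∈ K, |G n ω (c + w n ω) - F c|) l fun _ ↦ (0 : ℝ) := by
  rw [tendstoInMeasure_iff_norm] at hw ⊢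
  simp_rw [tendstoInMeasure_iff_norm] at hG
  intro ε hε
  obtain ⟨t, δ, hδ, h⟩ := hK.exists_finset_forall_monotone_abs_sub_le hF
    (show 0 < ε / 4 by positivity)
  have hlim := tendsto_finsetSum t fun c _ ↦ (hw (δ c) (hδ c)).add
    ((hG (c + 2 * δ c) (ε / 4) (by positivity)).add (hG (c - 2 * δ c) (ε / 4) (by positivity)))
  simp only [add_zero, Finset.sum_const_zero] at hlim
  refine tendsto_of_tendsto_of_tendsto_of_le_of_le tendsto_const_nhds hlim
    (fun _ ↦ zero_le) fun n ↦ ?_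
  have hsub : {ω | ε ≤ ‖(⨆ c ∈ K, |G n ω (c + w n ω) - F c|) - 0‖} ⊆
      ⋃ c ∈ t, {ω | δ c ≤ ‖w n ω - 0‖} ∪
        ({ω | ε / 4 ≤ ‖G n ω (c + 2 * δ c) - F (c + 2 * δ c)‖} ∪
          {ω | ε / 4 ≤ ‖G n ω (c - 2 * δ c) - F (c - 2 * δ c)‖}) := by
    intro ω hω
    by_contra hbad
    simp only [Set.mem_iUnion, Set.mem_union, Set.mem_ofPred_eq, not_exists, not_or, not_le,
      sub_zero, Real.norm_eq_abs] at hbad hω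
    have hle : ⨆ c ∈ K, |G n ω (c + w n ω) - F c| ≤ 3 * (ε / 4) :=
      Real.iSup_le (fun c ↦ Real.iSup_le (h (G n ω) (w n ω) (hmono n ω) hbad c) (by positivity))
        (by positivity)
    rw [abs_of_nonneg (Real.iSup_nonneg fun c ↦ Real.iSup_nonneg fun _ ↦ abs_nonneg _)] at hω
    linarith
  refine (measure_mono hsub).trans ((measure_biUnion_finset_le _ _).trans ?_)
  gcongr with c
  exact (measure_union_le _ _).trans (by gcongr; exact measure_union_le _ _)

/-- Proposition 1 (Ferman 2021): the residual empirical distribution function of the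
control units converges in probability to the common cdf `F`, uniformly on compact
subsets, even under cross-sectional dependence. -/
theorem residual_edf_uniform_convergence
    {Ω : Type*} [MeasureSpace Ω] [IsProbabilityMeasure (ℙ : Measure Ω)]
    (μ : Measure ℝ) [IsProbabilityMeasure μ]
    (F : ℝ → ℝ) (hF : ∀ c, F c = (μ (Set.Iic c)).toReal)
    (hFcont : Continuous F)
    (hmean : ∫ x, x ∂μ = 0)
    (hmom2 : ∫⁻ x, ENNReal.ofReal (x ^ 2) ∂μ < ⊤)
    (W : ℕ → Ω → ℝ) (hW : ∀ i, Measure.map (W i) ℙ = μ)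
    (Wbar : ℕ → Ω → ℝ)
    (hWbar : ∀ N ω, Wbar N ω = (N : ℝ)⁻¹ * ∑ i ∈ Finset.range N, W i ω)
    (Fhat : ℕ → Ω → ℝ → ℝ)
    (hFhat : ∀ N ω c, Fhat N ω c
      = (N : ℝ)⁻¹ * ∑ i ∈ Finset.range N, (if W i ω - Wbar N ω ≤ c then (1 : ℝ) else 0))
    -- mixing-type assumption: the average of the controls tends to 0 in probability
    (hmix1 : TendstoInMeasure ℙ Wbar atTop (fun _ => (0 : ℝ)))
    -- and a pointwise law of large numbers holds for the indicator averages
    (hmix2 : ∀ c : ℝ, TendstoInMeasure ℙ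
      (fun (N : ℕ) (ω : Ω) => (N : ℝ)⁻¹ * ∑ i ∈ Finset.range N, (if W i ω ≤ c then (1 : ℝ) else 0))
      atTop (fun _ => F c)) :
    ∀ K : Set ℝ, IsCompact K →
      TendstoInMeasure ℙ (fun N ω => ⨆ c ∈ K, |Fhat N ω c - F c|)
        atTop (fun _ => (0 : ℝ)) := by
  intro K hK
  simp only [hFhat, sub_le_iff_le_add]
  exact tendstoInMeasure_iSup_abs_translate_sub hFcont
    (fun n ω ↦ monotone_inv_mul_sum_ite_le (Finset.range n) (fun i ↦ W i ω) n) hmix1 hmix2 hK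
end

section
/- Suppose the null hypothesis is true (α = α₀), so that the test statistic is T_N = W⁰ − W̄_N, where W⁰ is the post–pre difference in average errors of the single treated unit. Consider the test that rejects if and only if F̂_N(T_N) ≤ τ/2 or F̂_N(T_N) > 1 − τ/2, for a significance level τ ∈ (0,1). Then ℙ(reject) → τ as N → ∞; in particular the test is asymptotically valid with a single treated unit even under cross-sectional dependence. -/
open MeasureTheory ProbabilityTheory Filter

/-- A continuous cumulative distribution function attains every value strictly between its
limits. -/
theorem exists_cdf_eq_of_continuous (μ : Measure ℝ) [IsProbabilityMeasure μ]
    (hcont : Continuous (cdf μ)) {p : ℝ} (hp : p ∈ Set.Ioo (0 : ℝ) 1) :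
    ∃ c, cdf μ c = p :=
  mem_range_of_exists_le_of_exists_ge hcont
    (((tendsto_cdf_atBot μ).eventually_le_const hp.1).exists)
    (((tendsto_cdf_atTop μ).eventually_const_le hp.2).exists)

/-- If a random monotone function converges pointwise in probability to the continuous
cumulative distribution function of `X`, then its value at `X` is asymptotically uniform, whatever
the dependence between the two. -/
theorem tendsto_measureReal_apply_le_of_tendstoInMeasure_cdf {Ω : Type*} [MeasurableSpace Ω]
    {P : Measure Ω} [IsProbabilityMeasure P] {μ : Measure ℝ} [IsProbabilityMeasure μ]
    (hcont : Continuous (cdf μ)) {G : ℕ → Ω → ℝ → ℝ} (hmono : ∀ N ω, Monotone (G N ω))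
    (hG : ∀ c, TendstoInMeasure P (fun N ω => G N ω c) atTop (fun _ => cdf μ c))
    {X : Ω → ℝ} (hX : AEMeasurable X P) (hmap : Measure.map X P = μ)
    {a : ℝ} (ha : a ∈ Set.Ioo (0 : ℝ) 1) :
    Tendsto (fun N => P.real {ω | G N ω (X ω) ≤ a}) atTop (nhds a) := by
  have hXle (c : ℝ) : P.real {ω | X ω ≤ c} = cdf μ c := by
    rw [cdf_eq_real, ← hmap, map_measureReal_apply_of_aemeasurable hX measurableSet_Iic]
    rfl
  have hdev (c δ : ℝ) (hδ : 0 < δ) :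
      Tendsto (fun N => P.real {ω | δ ≤ dist (G N ω c) (cdf μ c)}) atTop (nhds 0) :=
    (ENNReal.tendsto_toReal_zero_iff fun _ => measure_ne_top _ _).2
      (tendstoInMeasure_iff_dist.1 (hG c) δ hδ)
  refine tendsto_order.2 ⟨fun l hl => ?_, fun u hu => ?_⟩
  · obtain ⟨p, hlp, hpa⟩ := exists_between (max_lt hl ha.1)
    obtain ⟨hl_lt, hp0⟩ := max_lt_iff.1 hlp
    obtain ⟨c, rfl⟩ := exists_cdf_eq_of_continuous μ hcont ⟨hp0, hpa.trans ha.2⟩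
    filter_upwards [(hdev c _ (sub_pos.2 hpa)).eventually_lt_const (sub_pos.2 hl_lt)] with N hN
    have hsub : {ω | X ω ≤ c} ⊆
        {ω | G N ω (X ω) ≤ a} ∪ {ω | a - cdf μ c ≤ dist (G N ω c) (cdf μ c)} := by
      intro ω hω
      rcases le_or_gt (G N ω (X ω)) a with h | h
      · exact Or.inl h
      · right
        have h1 := hmono N ω hω
        have h2 := le_abs_self (G N ω c - cdf μ c)
        rw [Set.mem_ofPred_eq, Real.dist_eq]
        linarith
    have h := (measureReal_mono hsub).trans (measureReal_union_le (μ := P) _ _)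
    rw [hXle] at h
    linarith
  · obtain ⟨p, hap, hpu⟩ := exists_between (lt_min hu ha.2)
    obtain ⟨hp_lt, hp1⟩ := lt_min_iff.1 hpu
    obtain ⟨c, rfl⟩ := exists_cdf_eq_of_continuous μ hcont ⟨ha.1.trans hap, hp1⟩
    filter_upwards [(hdev c _ (sub_pos.2 hap)).eventually_lt_const (sub_pos.2 hp_lt)] with N hN
    have hsub : {ω | G N ω (X ω) ≤ a} ⊆
        {ω | X ω ≤ c} ∪ {ω | cdf μ c - a ≤ dist (G N ω c) (cdf μ c)} := by
      intro ω (hω : G N ω (X ω) ≤ a)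
      rcases le_or_gt (X ω) c with h | h
      · exact Or.inl h
      · right
        have h1 := hmono N ω h.le
        have h2 := neg_le_abs (G N ω c - cdf μ c)
        rw [Set.mem_ofPred_eq, Real.dist_eq]
        linarith
    have h := (measureReal_mono hsub).trans (measureReal_union_le (μ := P) _ _)
    rw [hXle] at h
    linarith

/-- Corollary 1 (Ferman 2021): with a single treated unit, the CT test based on the
residual empirical distribution function is asymptotically valid (rejection probability
converges to the nominal level τ) even under cross-sectional dependence. -/
theorem single_treated_test_asymptotically_valid
    {Ω : Type*} [MeasureSpace Ω] [IsProbabilityMeasure (ℙ : Measure Ω)]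
    (μ : Measure ℝ) [IsProbabilityMeasure μ]
    (F : ℝ → ℝ) (hF : ∀ c, F c = (μ (Set.Iic c)).toReal)
    (hFcont : Continuous F)
    (hmean : ∫ x, x ∂μ = 0)
    (hmom2 : ∫⁻ x, ENNReal.ofReal (x ^ 2) ∂μ < ⊤)
    (W : ℕ → Ω → ℝ) (hW : ∀ i, Measure.map (W i) ℙ = μ)
    (Wbar : ℕ → Ω → ℝ)
    (hWbar : ∀ N ω, Wbar N ω = (N : ℝ)⁻¹ * ∑ i ∈ Finset.range N, W i ω)
    (Fhat : ℕ → Ω → ℝ → ℝ)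
    (hFhat : ∀ N ω c, Fhat N ω c
      = (N : ℝ)⁻¹ * ∑ i ∈ Finset.range N, (if W i ω - Wbar N ω ≤ c then (1 : ℝ) else 0))
    (hmix1 : TendstoInMeasure ℙ Wbar atTop (fun _ => (0 : ℝ)))
    (hmix2 : ∀ c : ℝ, TendstoInMeasure ℙ
      (fun (N : ℕ) (ω : Ω) => (N : ℝ)⁻¹ * ∑ i ∈ Finset.range N,
        (if W i ω ≤ c then (1 : ℝ) else 0))
      atTop (fun _ => F c))
    -- the treated unit's error, with the same marginal law, arbitrarily dependent
    (W0 : Ω → ℝ) (hW0 : Measure.map W0 ℙ = μ)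
    -- under the null, the test statistic is T_N = W⁰ - W̄_N
    (T : ℕ → Ω → ℝ) (hT : ∀ N ω, T N ω = W0 ω - Wbar N ω)
    (τ : ℝ) (hτ : τ ∈ Set.Ioo (0 : ℝ) 1) :
    Tendsto (fun N : ℕ =>
        (ℙ {ω | Fhat N ω (T N ω) ≤ τ / 2 ∨ 1 - τ / 2 < Fhat N ω (T N ω)}).toReal)
      atTop (nhds τ) := by
  have hcdf : F = cdf μ := funext fun c => by rw [hF, cdf_eq_real]; rfl
  subst hcdf
  have aemeas {Y : Ω → ℝ} (hY : Measure.map Y ℙ = μ) : AEMeasurable Y ℙ :=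
    AEMeasurable.of_map_ne_zero (hY ▸ IsProbabilityMeasure.ne_zero μ)
  set G : ℕ → Ω → ℝ → ℝ := fun N ω c =>
    (N : ℝ)⁻¹ * ∑ i ∈ Finset.range N, (if W i ω ≤ c then (1 : ℝ) else 0) with hGdef
  have hFG (N : ℕ) (ω : Ω) : Fhat N ω (T N ω) = G N ω (W0 ω) := by
    simp only [hFhat, hT, hGdef, sub_le_sub_iff_right]
  have hmono (N : ℕ) (ω : Ω) : Monotone (G N ω) := fun x y hxy => by
    refine mul_le_mul_of_nonneg_left (Finset.sum_le_sum fun i _ => ?_) (by positivity)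
    split_ifs with h1 h2
    · exact le_rfl
    · exact absurd (h1.trans hxy) h2
    · exact zero_le_one
    · exact le_rfl
  have hstep : Measurable fun p : ℝ × ℝ => if p.1 ≤ p.2 then (1 : ℝ) else 0 :=
    Measurable.ite (measurableSet_le measurable_fst measurable_snd) measurable_const
      measurable_const
  have hmeas (N : ℕ) : AEMeasurable (fun ω => G N ω (W0 ω)) ℙ :=
    (Finset.aemeasurable_fun_sum _ fun i _ =>
      hstep.comp_aemeasurable ((aemeas (hW i)).prodMk (aemeas hW0))).const_mul _
  have hlim {a : ℝ} (ha : a ∈ Set.Ioo (0 : ℝ) 1) :=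
    tendsto_measureReal_apply_le_of_tendstoInMeasure_cdf hFcont hmono hmix2 (aemeas hW0) hW0 ha
  obtain ⟨hτ0, hτ1⟩ := hτ
  have hlower := hlim (a := τ / 2) ⟨by linarith, by linarith⟩
  have hupper := hlim (a := 1 - τ / 2) ⟨by linarith, by linarith⟩
  have hsum := hlower.add (hupper.const_sub 1)
  rw [show τ / 2 + (1 - (1 - τ / 2)) = τ by ring] at hsum
  refine hsum.congr fun N => ?_
  have hnull (a : ℝ) : NullMeasurableSet {ω | G N ω (W0 ω) ≤ a} ℙ :=
    (hmeas N).nullMeasurable measurableSet_Iic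
  have hcompl : {ω | 1 - τ / 2 < G N ω (W0 ω)} = {ω | G N ω (W0 ω) ≤ 1 - τ / 2}ᶜ := by
    ext ω
    simp
  have hdisj : Disjoint {ω | G N ω (W0 ω) ≤ τ / 2} {ω | 1 - τ / 2 < G N ω (W0 ω)} :=
    Set.disjoint_left.2 fun ω (h1 : G N ω (W0 ω) ≤ τ / 2)
      (h2 : 1 - τ / 2 < G N ω (W0 ω)) => by linarith
  simp only [hFG]
  rw [← measureReal_def, Set.ofPred_or, measureReal_union₀ (hcompl ▸ (hnull _).compl)
    hdisj.aedisjoint, hcompl, probReal_compl_eq_one_sub₀ (hnull _)]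
end

section
/- Consider the conservative test at level τ ∈ (0,1) that rejects if and only if F̂_N(T_N) ≤ τ/2 or F̂_N(T_N) > 1 − τ/2, where T_N = W̃ − W̄_N is the test statistic under the null hypothesis. Under the regularity condition ℙ(W̃ ≤ c_{τ/2}) + ℙ(W̃ > c_{1−τ/2}) ≤ τ, the test is asymptotically level τ: limsup_{N → ∞} ℙ(reject) ≤ τ. -/
open MeasureTheory ProbabilityTheory Filter

/-- A distribution function is right-continuous: the mass below a level slightly above `a` is
at most `ε` more than the mass below `a`. -/
lemma exists_gt_measureReal_le_add {Ω : Type*} [MeasurableSpace Ω] {P : Measure Ω}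
    [IsProbabilityMeasure P] {X : Ω → ℝ} (hX : AEMeasurable X P) (a : ℝ) {ε : ℝ} (hε : 0 < ε) :
    ∃ c, a < c ∧ P.real {ω | X ω ≤ c} ≤ P.real {ω | X ω ≤ a} + ε := by
  have : IsProbabilityMeasure (P.map X) := Measure.isProbabilityMeasure_map hX
  have hcdf : ∀ x, cdf (P.map X) x = P.real {ω | X ω ≤ x} := fun x => by
    rw [cdf_eq_real, measureReal_def, Measure.map_apply_of_aemeasurable hX measurableSet_Iic]
    rfl
  have hcont : Tendsto (cdf (P.map X)) (nhdsWithin a (Set.Ioi a)) (nhds (cdf (P.map X) a)) :=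
    ((cdf (P.map X)).right_continuous a).mono Set.Ioi_subset_Ici_self
  have hlt := hcont.eventually (gt_mem_nhds (lt_add_of_pos_right _ hε))
  obtain ⟨c, hc, hac⟩ := (hlt.and self_mem_nhdsWithin).exists
  exact ⟨c, hac, by simpa only [hcdf] using hc.le⟩

/-- The mass above a level slightly below `a` is at most `ε` more than the mass of `[a, ∞)`. -/
lemma exists_lt_measureReal_lt_le_add {Ω : Type*} [MeasurableSpace Ω] {P : Measure Ω}
    [IsProbabilityMeasure P] {X : Ω → ℝ} (hX : AEMeasurable X P) (a : ℝ) {ε : ℝ} (hε : 0 < ε) :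
    ∃ c, c < a ∧ P.real {ω | c < X ω} ≤ P.real {ω | a ≤ X ω} + ε := by
  obtain ⟨c, hc, h⟩ := exists_gt_measureReal_le_add hX.neg (-a) hε
  refine ⟨-c, by linarith, ?_⟩
  have ha : {ω | (-X) ω ≤ -a} = {ω | a ≤ X ω} := by ext ω; simp
  rw [ha] at h
  refine (measureReal_mono fun ω hω => ?_).trans h
  simp only [Set.mem_ofPred_eq, Pi.neg_apply] at hω ⊢
  linarith

/-- The superlevel set of a distribution function at a level in `(0, 1)` is nonempty and bounded
below, so that its infimum is a genuine quantile. -/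
lemma cdf_superlevel_nonempty_bddBelow (μ : Measure ℝ) [IsProbabilityMeasure μ] {q : ℝ}
    (hq : q ∈ Set.Ioo (0 : ℝ) 1) :
    {c | q ≤ cdf μ c}.Nonempty ∧ BddBelow {c | q ≤ cdf μ c} := by
  obtain ⟨b, hb⟩ := ((tendsto_cdf_atTop μ).eventually (lt_mem_nhds hq.2)).exists
  obtain ⟨a, ha⟩ := ((tendsto_cdf_atBot μ).eventually (gt_mem_nhds hq.1)).exists
  refine ⟨⟨b, hb.le⟩, a, fun c hc => ?_⟩
  by_contra! hca
  exact absurd (hc.trans (monotone_cdf μ hca.le)) (not_le.2 ha)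

/-- Variables converging in probability to a constant eventually have little mass at distance at
least `δ` from it. -/
lemma MeasureTheory.TendstoInMeasure.eventually_measureReal_le {Ω : Type*} [MeasurableSpace Ω]
    {P : Measure Ω} [IsFiniteMeasure P] {X : ℕ → Ω → ℝ} {a : ℝ}
    (h : TendstoInMeasure P X atTop (fun _ => a)) {δ ε : ℝ} (hδ : 0 < δ) (hε : 0 < ε) :
    ∀ᶠ N in atTop, P.real {ω | δ ≤ |X N ω - a|} ≤ ε := by
  have hlim := tendstoInMeasure_iff_measureReal_norm.1 h δ hδ
  simp only [Real.norm_eq_abs] at hlim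
  exact (hlim.eventually (gt_mem_nhds hε)).mono fun _ hN => hN.le

/-- Proposition 2 (Ferman 2021): the conservative test with N₁ treated units is
asymptotically level τ under the regularity condition (Assumption 2). -/
theorem conservative_test_asymptotically_level
    {Ω : Type*} [MeasureSpace Ω] [IsProbabilityMeasure (ℙ : Measure Ω)]
    (μ : Measure ℝ) [IsProbabilityMeasure μ]
    (F : ℝ → ℝ) (hF : ∀ c, F c = (μ (Set.Iic c)).toReal)
    (hFcont : Continuous F) (hFmono : StrictMono F)
    (hmean : ∫ x, x ∂μ = 0)
    (hmom2 : ∫⁻ x, ENNReal.ofReal (x ^ 2) ∂μ < ⊤)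
    -- quantiles of μ
    (cq : ℝ → ℝ) (hcq : ∀ q : ℝ, cq q = sInf {c : ℝ | q ≤ F c})
    -- control-unit errors, identically distributed, arbitrarily dependent
    (W : ℕ → Ω → ℝ) (hW : ∀ i, Measure.map (W i) ℙ = μ)
    (Wbar : ℕ → Ω → ℝ)
    (hWbar : ∀ N ω, Wbar N ω = (N : ℝ)⁻¹ * ∑ i ∈ Finset.range N, W i ω)
    (Fhat : ℕ → Ω → ℝ → ℝ)
    (hFhat : ∀ N ω c, Fhat N ω c
      = (N : ℝ)⁻¹ * ∑ i ∈ Finset.range N, (if W i ω - Wbar N ω ≤ c then (1 : ℝ) else 0))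
    (hmix1 : TendstoInMeasure ℙ Wbar atTop (fun _ => (0 : ℝ)))
    (hmix2 : ∀ c : ℝ, TendstoInMeasure ℙ
      (fun (N : ℕ) (ω : Ω) => (N : ℝ)⁻¹ * ∑ i ∈ Finset.range N,
        (if W i ω ≤ c then (1 : ℝ) else 0))
      atTop (fun _ => F c))
    -- treated-unit errors, each with law μ, arbitrarily dependent
    (N₁ : ℕ) (hN₁ : 0 < N₁)
    (Wt : Fin N₁ → Ω → ℝ) (hWt : ∀ j, Measure.map (Wt j) ℙ = μ)
    (Wtilde : Ω → ℝ) (hWtilde : ∀ ω, Wtilde ω = (N₁ : ℝ)⁻¹ * ∑ j, Wt j ω)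
    (τ : ℝ) (hτ : τ ∈ Set.Ioo (0 : ℝ) 1)
    -- the law of W̃ assigns zero mass to the two quantiles
    (hnoatom1 : ℙ {ω | Wtilde ω = cq (τ / 2)} = 0)
    (hnoatom2 : ℙ {ω | Wtilde ω = cq (1 - τ / 2)} = 0)
    -- regularity condition (Assumption 2)
    (hreg : (ℙ {ω | Wtilde ω ≤ cq (τ / 2)}).toReal
        + (ℙ {ω | cq (1 - τ / 2) < Wtilde ω}).toReal ≤ τ)
    -- under the null, the test statistic is T_N = W̃ - W̄_N
    (T : ℕ → Ω → ℝ) (hT : ∀ N ω, T N ω = Wtilde ω - Wbar N ω) :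
    limsup (fun N : ℕ =>
        (ℙ {ω | Fhat N ω (T N ω) ≤ τ / 2 ∨ 1 - τ / 2 < Fhat N ω (T N ω)}).toReal)
      atTop ≤ τ := by
  have hWt_meas : ∀ j, AEMeasurable (Wt j) ℙ := fun j =>
    AEMeasurable.of_map_ne_zero (by rw [hWt j]; exact IsProbabilityMeasure.ne_zero μ)
  have hX : AEMeasurable Wtilde ℙ := by
    rw [funext hWtilde]
    exact (Finset.aemeasurable_fun_sum _ fun j _ => hWt_meas j).const_mul _
  have hFcdf : ∀ c, F c = cdf μ c := fun c => by rw [hF, cdf_eq_real, measureReal_def]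
  have hquant : ∀ {q : ℝ}, q ∈ Set.Ioo (0 : ℝ) 1 →
      {c | q ≤ F c}.Nonempty ∧ BddBelow {c | q ≤ F c} := fun hq => by
    simpa only [hFcdf] using cdf_superlevel_nonempty_bddBelow μ hq
  have hτ0 := hτ.1
  have hτ1 := hτ.2
  have hFgt : ∀ c, cq (τ / 2) < c → τ / 2 < F c := fun c hc => by
    rw [hcq] at hc
    obtain ⟨b, hb, hbc⟩ := exists_lt_of_csInf_lt (hquant ⟨by linarith, by linarith⟩).1 hc
    exact lt_of_le_of_lt hb (hFmono hbc)
  have hFlt : ∀ c, c < cq (1 - τ / 2) → F c < 1 - τ / 2 := fun c hc => by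
    rw [hcq] at hc
    have hnot := notMem_of_lt_csInf hc (hquant ⟨by linarith, by linarith⟩).2
    exact not_le.1 hnot
  have hupper : (ℙ : Measure Ω).real {ω | cq (1 - τ / 2) ≤ Wtilde ω}
      ≤ (ℙ : Measure Ω).real {ω | cq (1 - τ / 2) < Wtilde ω} := by
    have hnull : (ℙ : Measure Ω).real {ω | Wtilde ω = cq (1 - τ / 2)} = 0 := by
      rw [measureReal_def, hnoatom2, ENNReal.toReal_zero]
    calc (ℙ : Measure Ω).real {ω | cq (1 - τ / 2) ≤ Wtilde ω} ≤ (ℙ : Measure Ω).real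
          ({ω | cq (1 - τ / 2) < Wtilde ω} ∪ {ω | Wtilde ω = cq (1 - τ / 2)}) :=
          measureReal_mono fun ω (hω : cq (1 - τ / 2) ≤ Wtilde ω) =>
            (lt_or_eq_of_le hω).imp id Eq.symm
      _ ≤ _ := (measureReal_union_le _ _).trans (by rw [hnull, add_zero])
  set G : ℕ → ℝ → Ω → ℝ := fun N c ω =>
    (N : ℝ)⁻¹ * ∑ i ∈ Finset.range N, (if W i ω ≤ c then (1 : ℝ) else 0) with hG
  have hFG : ∀ N ω, Fhat N ω (T N ω) = G N (Wtilde ω) ω := fun N ω => by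
    simp only [hFhat, hT, hG, sub_le_sub_iff_right]
  have hGmono : ∀ N ω, Monotone fun c => G N c ω := fun N ω a b hab => by
    refine mul_le_mul_of_nonneg_left (Finset.sum_le_sum fun i _ => ?_) (by positivity)
    split_ifs with h₁ h₂
    · exact le_rfl
    · exact absurd (h₁.trans hab) h₂
    · exact zero_le_one
    · exact le_rfl
  refine le_of_forall_pos_le_add fun ε hε => ?_
  have hε4 : 0 < ε / 4 := by positivity
  obtain ⟨a, ha, hPa⟩ := exists_gt_measureReal_le_add hX (cq (τ / 2)) hε4
  obtain ⟨b, hb, hPb⟩ := exists_lt_measureReal_lt_le_add hX (cq (1 - τ / 2)) hε4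
  have hlow := (hmix2 a).eventually_measureReal_le (sub_pos.2 (hFgt a ha)) hε4
  have hupp := (hmix2 b).eventually_measureReal_le (sub_pos.2 (hFlt b hb)) hε4
  refine limsup_le_of_le
    (isCoboundedUnder_le_of_le atTop (x := 0) fun _ => ENNReal.toReal_nonneg) ?_
  filter_upwards [hlow, hupp] with N hNa hNb
  have hsub : {ω | Fhat N ω (T N ω) ≤ τ / 2 ∨ 1 - τ / 2 < Fhat N ω (T N ω)} ⊆
      ({ω | Wtilde ω ≤ a} ∪ {ω | F a - τ / 2 ≤ |G N a ω - F a|}) ∪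
      ({ω | b < Wtilde ω} ∪ {ω | 1 - τ / 2 - F b ≤ |G N b ω - F b|}) := by
    intro ω hω
    rw [Set.mem_ofPred_eq, hFG] at hω
    refine hω.imp (fun h => ?_) (fun h => ?_)
    · refine (le_or_gt (Wtilde ω) a).imp id fun hlt => ?_
      have hle : G N a ω ≤ G N (Wtilde ω) ω := hGmono N ω hlt.le
      have hdev : F a - τ / 2 ≤ -(G N a ω - F a) := by linarith
      exact hdev.trans (neg_le_abs _)
    · refine (lt_or_ge b (Wtilde ω)).imp id fun hge => ?_
      have hle : G N (Wtilde ω) ω ≤ G N b ω := hGmono N ω hge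
      have hdev : 1 - τ / 2 - F b ≤ G N b ω - F b := by linarith
      exact hdev.trans (le_abs_self _)
  have hreal := measureReal_mono (μ := (ℙ : Measure Ω)) hsub
  have hu := measureReal_union_le (μ := (ℙ : Measure Ω))
    ({ω | Wtilde ω ≤ a} ∪ {ω | F a - τ / 2 ≤ |G N a ω - F a|})
    ({ω | b < Wtilde ω} ∪ {ω | 1 - τ / 2 - F b ≤ |G N b ω - F b|})
  have hua := measureReal_union_le (μ := (ℙ : Measure Ω))
    {ω | Wtilde ω ≤ a} {ω | F a - τ / 2 ≤ |G N a ω - F a|}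
  have hub := measureReal_union_le (μ := (ℙ : Measure Ω))
    {ω | b < Wtilde ω} {ω | 1 - τ / 2 - F b ≤ |G N b ω - F b|}
  simp only [← measureReal_def] at hreg ⊢
  linarith
end

section
/- With a single treated unit, the heteroskedasticity-corrected test is asymptotically valid: if the null hypothesis holds, so that the statistic T_N satisfies T_N − W⁰ → 0 in probability, and the test rejects if and only if Ĝ_N(h(z₁, δ̂_N)⁻¹ T_N) ≤ τ/2 or Ĝ_N(h(z₁, δ̂_N)⁻¹ T_N) > 1 − τ/2, for τ ∈ (0,1), then ℙ(reject) → τ as N → ∞. -/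
open MeasureTheory ProbabilityTheory Filter

open Set Topology in
/-- A continuous cdf on `ℝ` satisfies `ν {G ≤ s} = s` for `0 < s < 1`. -/
lemma measureReal_cdf_le (ν : Measure ℝ) [IsProbabilityMeasure ν]
    {G : ℝ → ℝ} (hG : ∀ c, G c = (ν (Iic c)).toReal) (hGcont : Continuous G)
    {s : ℝ} (hs : s ∈ Ioo (0 : ℝ) 1) : ν.real {x | G x ≤ s} = s := by
  have hGcdf : G = cdf ν := by
    ext c
    rw [hG, cdf_eq_real, measureReal_def]
  have hmono : Monotone G := hGcdf ▸ monotone_cdf ν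
  have h0 : Tendsto G atBot (𝓝 0) := hGcdf ▸ tendsto_cdf_atBot ν
  have h1 : Tendsto G atTop (𝓝 1) := hGcdf ▸ tendsto_cdf_atTop ν
  obtain ⟨a, ha⟩ := (h0.eventually_lt_const hs.1).exists
  obtain ⟨b, hb⟩ := (h1.eventually_const_lt hs.2).exists
  have hne : (G ⁻¹' {s}).Nonempty := by
    obtain ⟨c, hc⟩ := mem_range_of_exists_le_of_exists_ge hGcont ⟨a, ha.le⟩ ⟨b, hb.le⟩
    exact ⟨c, hc⟩
  have hbdd : BddAbove (G ⁻¹' {s}) := by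
    refine ⟨b, fun x hx => ?_⟩
    by_contra! hbx
    have hxs : G x = s := hx
    linarith [hmono hbx.le]
  set c := sSup (G ⁻¹' {s})
  have hc : G c = s := (isClosed_singleton.preimage hGcont).csSup_mem hne hbdd
  have hset : {x | G x ≤ s} = Iic c := by
    ext x
    refine ⟨fun hx => ?_, fun hx => (hmono hx).trans hc.le⟩
    by_contra hxc
    have hcx : c < x := not_le.mp hxc
    exact hxc (le_csSup hbdd (le_antisymm hx (hc ▸ hmono hcx.le)))
  rw [hset, measureReal_def, ← hG, hc]

/-- If `Y` has a continuous cdf `G`, then `G ∘ Y` is uniform; here in the form of the probability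
of a two-sided tail event. -/
lemma measureReal_cdf_le_or_lt {Ω : Type*} [MeasurableSpace Ω] {μ : Measure Ω}
    (ν : Measure ℝ) [IsProbabilityMeasure ν]
    {G : ℝ → ℝ} (hG : ∀ c, G c = (ν (Set.Iic c)).toReal) (hGcont : Continuous G)
    {Y : Ω → ℝ} (hY : Measure.map Y μ = ν) {s t : ℝ} (hs : 0 < s) (hst : s < t) (ht : t < 1) :
    μ.real {ω | G (Y ω) ≤ s ∨ t < G (Y ω)} = s + (1 - t) := by
  have hYm : AEMeasurable Y μ := aemeasurable_of_map_neZero (by rw [hY]; infer_instance)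
  have hle : ∀ r, MeasurableSet {x | G x ≤ r} := fun r =>
    measurableSet_le hGcont.measurable measurable_const
  have hset : {x | G x ≤ s ∨ t < G x} = {x | G x ≤ s} ∪ {x | G x ≤ t}ᶜ := by
    ext x
    simp
  have hmeas : MeasurableSet {x | G x ≤ s ∨ t < G x} := hset ▸ (hle s).union (hle t).compl
  have hmap : μ.real {ω | G (Y ω) ≤ s ∨ t < G (Y ω)} = ν.real {x | G x ≤ s ∨ t < G x} := by
    rw [← hY, map_measureReal_apply_of_aemeasurable hYm hmeas]
    rfl
  have hdisj : Disjoint {x | G x ≤ s} {x | G x ≤ t}ᶜ := by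
    rw [Set.disjoint_compl_right_iff_subset]
    exact fun x hx => le_trans hx hst.le
  rw [hmap, hset, measureReal_union hdisj (hle t).compl, probReal_compl_eq_one_sub (hle t),
    measureReal_cdf_le ν hG hGcont ⟨hs, hst.trans ht⟩,
    measureReal_cdf_le ν hG hGcont ⟨hs.trans hst, ht⟩]

lemma TendstoInMeasure.prodMk {Ω ι E F : Type*} [MeasurableSpace Ω] {μ : Measure Ω}
    {l : Filter ι} [PseudoEMetricSpace E] [PseudoEMetricSpace F] {f : ι → Ω → E} {f' : Ω → E}
    {g : ι → Ω → F} {g' : Ω → F}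
    (hf : TendstoInMeasure μ f l f') (hg : TendstoInMeasure μ g l g') :
    TendstoInMeasure μ (fun i ω => (f i ω, g i ω)) l (fun ω => (f' ω, g' ω)) := by
  intro ε hε
  have hsum := (hf ε hε).add (hg ε hε)
  rw [add_zero] at hsum
  refine tendsto_of_tendsto_of_tendsto_of_le_of_le tendsto_const_nhds hsum
    (fun _ => zero_le) (fun i => ?_)
  refine (measure_mono fun ω hω => ?_).trans (measure_union_le _ _)
  simpa [Prod.edist_eq] using hω

lemma tendstoInMeasure_const {Ω ι E : Type*} [MeasurableSpace Ω] {μ : Measure Ω}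
    {l : Filter ι} [PseudoEMetricSpace E] (f : Ω → E) :
    TendstoInMeasure μ (fun _ : ι => f) l f := by
  intro ε hε
  simpa [edist_self, hε.ne'] using tendsto_const_nhds

/-- Continuous mapping theorem for convergence in measure, with a possibly random limit and
no measurability of the approximating functions. -/
lemma TendstoInMeasure.continuous_comp {Ω ι S E : Type*} [MeasurableSpace Ω] {μ : Measure Ω}
    [IsFiniteMeasure μ] {l : Filter ι} [PseudoMetricSpace S] [CompleteSpace S]
    [SecondCountableTopology S] [MeasurableSpace S] [BorelSpace S] [PseudoMetricSpace E]
    {Y : ι → Ω → S} {Y' : Ω → S} (hY : TendstoInMeasure μ Y l Y') (hY' : AEMeasurable Y' μ)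
    {f : S → E} (hf : Continuous f) :
    TendstoInMeasure μ (fun i ω => f (Y i ω)) l (fun ω => f (Y' ω)) := by
  rw [tendstoInMeasure_iff_dist] at hY ⊢
  intro ε hε
  rw [ENNReal.tendsto_nhds_zero]
  intro η hη
  obtain ⟨K, hK, hKle⟩ := isTightMeasureSet_iff_exists_isCompact_measure_compl_le.1
    (isTightMeasureSet_singleton (μ := Measure.map Y' μ)) (η / 2) (ENNReal.half_pos hη.ne')
  have hKY : μ (Y' ⁻¹' Kᶜ) ≤ η / 2 :=
    (Measure.le_map_apply hY' _).trans (hKle _ rfl)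
  obtain ⟨r, hr, hrK⟩ := Metric.mem_uniformity_dist.1
    (hK.uniformContinuousAt_of_continuousAt f (fun x _ => hf.continuousAt)
      (Metric.dist_mem_uniformity hε))
  filter_upwards [ENNReal.tendsto_nhds_zero.1 (hY r hr) (η / 2) (ENNReal.half_pos hη.ne')]
    with i hi
  calc μ {ω | ε ≤ dist (f (Y i ω)) (f (Y' ω))}
      ≤ μ (Y' ⁻¹' Kᶜ ∪ {ω | r ≤ dist (Y i ω) (Y' ω)}) := by
        refine measure_mono fun ω hω => ?_
        by_contra hcon
        simp only [Set.mem_union, Set.mem_preimage, Set.mem_compl_iff, Set.mem_ofPred_eq, not_or,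
          not_not, not_le] at hcon
        have hlt : dist (f (Y' ω)) (f (Y i ω)) < ε :=
          hrK (dist_comm (Y i ω) (Y' ω) ▸ hcon.2) hcon.1
        rw [dist_comm] at hlt
        exact not_le.2 hlt hω
    _ ≤ η / 2 + η / 2 := (measure_union_le _ _).trans (add_le_add hKY hi)
    _ = η := ENNReal.add_halves η

/-- Random functions converging in measure to `Φ`, uniformly on compact sets, may be evaluated
along a sequence of random points converging in measure. -/
lemma TendstoInMeasure.comp_of_uniform_on_compacts {Ω ι S : Type*} [MeasurableSpace Ω]
    {μ : Measure Ω} [IsFiniteMeasure μ] {l : Filter ι} [PseudoMetricSpace S] [ProperSpace S]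
    [MeasurableSpace S] [BorelSpace S]
    {F : ι → Ω → S → ℝ} {Φ : S → ℝ} (hΦ : Continuous Φ)
    (hF : ∀ C, IsCompact C → ∀ ε : ℝ, 0 < ε →
      Tendsto (fun i => μ {ω | ∃ x ∈ C, ε ≤ |F i ω x - Φ x|}) l (nhds 0))
    {Y : ι → Ω → S} {Y' : Ω → S} (hY : TendstoInMeasure μ Y l Y') (hY' : AEMeasurable Y' μ) :
    TendstoInMeasure μ (fun i ω => F i ω (Y i ω)) l (fun ω => Φ (Y' ω)) := by
  have hΦY := TendstoInMeasure.continuous_comp hY hY' hΦ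
  rw [tendstoInMeasure_iff_dist] at hY hΦY ⊢
  intro ε hε
  rw [ENNReal.tendsto_nhds_zero]
  intro η hη
  have hη4 : 0 < η / 2 / 2 := ENNReal.half_pos (ENNReal.half_pos hη.ne').ne'
  obtain ⟨K, hK, hKle⟩ := isTightMeasureSet_iff_exists_isCompact_measure_compl_le.1
    (isTightMeasureSet_singleton (μ := Measure.map Y' μ)) _ hη4
  have hKY : μ (Y' ⁻¹' Kᶜ) ≤ η / 2 / 2 :=
    (Measure.le_map_apply hY' _).trans (hKle _ rfl)
  filter_upwards [ENNReal.tendsto_nhds_zero.1 (hY 1 one_pos) _ hη4,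
    ENNReal.tendsto_nhds_zero.1 (hF _ hK.cthickening (ε / 2) (half_pos hε)) _ hη4,
    ENNReal.tendsto_nhds_zero.1 (hΦY (ε / 2) (half_pos hε)) _ hη4] with i hi₁ hi₂ hi₃
  calc μ {ω | ε ≤ dist (F i ω (Y i ω)) (Φ (Y' ω))}
      ≤ μ ((Y' ⁻¹' Kᶜ ∪ {ω | 1 ≤ dist (Y i ω) (Y' ω)}) ∪
          ({ω | ∃ x ∈ Metric.cthickening 1 K, ε / 2 ≤ |F i ω x - Φ x|} ∪
            {ω | ε / 2 ≤ dist (Φ (Y i ω)) (Φ (Y' ω))})) := by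
        refine measure_mono fun ω hω => ?_
        by_contra hcon
        simp only [Set.mem_union, Set.mem_preimage, Set.mem_compl_iff, Set.mem_ofPred_eq, not_or,
          not_not, not_le, not_exists, not_and] at hcon
        obtain ⟨⟨h₁, h₂⟩, h₃, h₄⟩ := hcon
        have h₅ := h₃ (Y i ω) (Metric.mem_cthickening_of_dist_le _ _ _ _ h₁ h₂.le)
        have h₆ := dist_triangle (F i ω (Y i ω)) (Φ (Y i ω)) (Φ (Y' ω))
        rw [Real.dist_eq (F i ω (Y i ω)) (Φ (Y i ω))] at h₆
        have hω' : ε ≤ dist (F i ω (Y i ω)) (Φ (Y' ω)) := hω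
        linarith
    _ ≤ (η / 2 / 2 + η / 2 / 2) + (η / 2 / 2 + η / 2 / 2) :=
        (measure_union_le _ _).trans (add_le_add
          ((measure_union_le _ _).trans (add_le_add hKY hi₁))
          ((measure_union_le _ _).trans (add_le_add hi₂ hi₃)))
    _ = η := by rw [ENNReal.add_halves, ENNReal.add_halves]

/-- If `V` converges in measure to `G ∘ Y`, where `G` is the continuous cdf of `Y`, then the
equal-tailed test based on `V` has asymptotic level `τ`. -/
lemma tendsto_measureReal_twoSided_of_tendstoInMeasure {Ω ι : Type*} [MeasurableSpace Ω]
    {μ : Measure Ω} [IsFiniteMeasure μ] {l : Filter ι} (ν : Measure ℝ) [IsProbabilityMeasure ν]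
    {G : ℝ → ℝ} (hG : ∀ c, G c = (ν (Set.Iic c)).toReal) (hGcont : Continuous G)
    {Y : Ω → ℝ} (hY : Measure.map Y μ = ν) {V : ι → Ω → ℝ}
    (hV : TendstoInMeasure μ V l (fun ω => G (Y ω))) {τ : ℝ} (hτ : τ ∈ Set.Ioo (0 : ℝ) 1) :
    Tendsto (fun i => μ.real {ω | V i ω ≤ τ / 2 ∨ 1 - τ / 2 < V i ω}) l (nhds τ) := by
  rw [tendstoInMeasure_iff_measureReal_dist] at hV
  obtain ⟨hτ0, hτ1⟩ := hτ
  rw [Metric.tendsto_nhds]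
  intro η hη
  obtain ⟨ε, hε, hεm⟩ : ∃ ε, 0 < ε ∧ ε < min (η / 4) (min (τ / 4) ((1 - τ) / 4)) :=
    exists_between (by simp only [lt_min_iff]; refine ⟨?_, ?_, ?_⟩ <;> linarith)
  simp only [lt_min_iff] at hεm
  obtain ⟨hεη, hετ, hετ'⟩ := hεm
  have hupper := measureReal_cdf_le_or_lt ν hG hGcont hY (s := τ / 2 + ε) (t := 1 - τ / 2 - ε)
    (by linarith) (by linarith) (by linarith)
  have hlower := measureReal_cdf_le_or_lt ν hG hGcont hY (s := τ / 2 - ε) (t := 1 - τ / 2 + ε)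
    (by linarith) (by linarith) (by linarith)
  filter_upwards [(hV ε hε).eventually_lt_const (half_pos hη)] with i hi
  have h₁ : μ.real {ω | V i ω ≤ τ / 2 ∨ 1 - τ / 2 < V i ω} ≤
      μ.real {ω | G (Y ω) ≤ τ / 2 + ε ∨ 1 - τ / 2 - ε < G (Y ω)} +
        μ.real {ω | ε ≤ dist (V i ω) (G (Y ω))} := by
    refine (measureReal_mono fun ω hω => ?_).trans (measureReal_union_le _ _)
    rcases le_or_gt ε (dist (V i ω) (G (Y ω))) with hd | hd
    · exact Or.inr hd
    · rw [Real.dist_eq, abs_lt] at hd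
      exact Or.inl (hω.imp (fun _ => by linarith) fun _ => by linarith)
  have h₂ : μ.real {ω | G (Y ω) ≤ τ / 2 - ε ∨ 1 - τ / 2 + ε < G (Y ω)} ≤
      μ.real {ω | V i ω ≤ τ / 2 ∨ 1 - τ / 2 < V i ω} +
        μ.real {ω | ε ≤ dist (V i ω) (G (Y ω))} := by
    refine (measureReal_mono fun ω hω => ?_).trans (measureReal_union_le _ _)
    rcases le_or_gt ε (dist (V i ω) (G (Y ω))) with hd | hd
    · exact Or.inr hd
    · rw [Real.dist_eq, abs_lt] at hd
      exact Or.inl (hω.imp (fun _ => by linarith) fun _ => by linarith)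
  rw [Real.dist_eq, abs_lt]
  constructor <;> linarith

lemma inv_mul_sum_ite_mem_Icc (N : ℕ) (P : ℕ → Prop) [DecidablePred P] :
    (N : ℝ)⁻¹ * ∑ i ∈ Finset.range N, (if P i then (1 : ℝ) else 0) ∈ Set.Icc (0 : ℝ) 1 := by
  constructor
  · positivity
  · have hsum : ∑ i ∈ Finset.range N, (if P i then (1 : ℝ) else 0) ≤ N := by
      rw [Finset.sum_boole]
      exact_mod_cast (Finset.card_filter_le _ _).trans (Finset.card_range N).le
    rw [inv_mul_eq_div]
    exact div_le_one_of_le₀ hsum (Nat.cast_nonneg N)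

lemma le_biSup_of_forall_le {α : Type*} {s : Set α} {f : α → ℝ} {b : ℝ}
    (hb : 0 ≤ b) (hf : ∀ x, f x ≤ b) {x : α} (hx : x ∈ s) : f x ≤ ⨆ y ∈ s, f y := by
  have hinner : ∀ y, ⨆ _ : y ∈ s, f y ≤ b := fun y => Real.iSup_le (fun _ => hf y) hb
  calc f x ≤ ⨆ _ : x ∈ s, f x := by rw [ciSup_pos hx]
    _ ≤ _ := le_ciSup (f := fun y => ⨆ _ : y ∈ s, f y) ⟨b, by rintro _ ⟨y, rfl⟩; exact hinner y⟩ x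

/-- Corollary 2 (Ferman 2021): with a single treated unit, the heteroskedasticity-
corrected (FP) test is asymptotically valid: the rejection probability converges to
the nominal level τ, even under cross-sectional dependence. -/
theorem single_treated_heteroskedastic_test_asymptotically_valid
    {Ω : Type*} [MeasureSpace Ω] [IsProbabilityMeasure (ℙ : Measure Ω)]
    (p q m : ℕ) (hp : 1 ≤ p) (hq : 1 ≤ q) (hm : 1 ≤ m)
    (ν : Measure ℝ) [IsProbabilityMeasure ν]
    (G : ℝ → ℝ) (hG : ∀ c, G c = (ν (Set.Iic c)).toReal)
    (hGcont : Continuous G)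
    (hmom2 : ∫⁻ x, ENNReal.ofReal (x ^ 2) ∂ν < ⊤)
    -- heteroskedasticity function, continuous and strictly positive
    (h : (Fin q → ℝ) → (Fin m → ℝ) → ℝ)
    (hhcont : Continuous (fun zd : (Fin q → ℝ) × (Fin m → ℝ) => h zd.1 zd.2))
    (hhpos : ∀ z d, 0 < h z d)
    -- true parameters
    (δ : Fin m → ℝ) (β : Fin p → ℝ) (xbar₀ : Fin p → ℝ)
    -- data: identically jointly distributed triples, ξᵢ with law ν
    (Z : ℕ → Ω → (Fin q → ℝ)) (X : ℕ → Ω → (Fin p → ℝ)) (ξ : ℕ → Ω → ℝ)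
    (hlaw : ∀ i, Measure.map (fun ω => (Z i ω, X i ω, ξ i ω)) ℙ
      = Measure.map (fun ω => (Z 0 ω, X 0 ω, ξ 0 ω)) ℙ)
    (hξ : ∀ i, Measure.map (ξ i) ℙ = ν)
    -- errors W_i = h(Z_i, δ) ξ_i
    (W : ℕ → Ω → ℝ) (hWdef : ∀ i ω, W i ω = h (Z i ω) δ * ξ i ω)
    -- consistent estimator sequences
    (δhat : ℕ → Ω → (Fin m → ℝ)) (βhat : ℕ → Ω → (Fin p → ℝ))
    (vhat : ℕ → Ω → ℝ) (Xbar : ℕ → Ω → (Fin p → ℝ))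
    (hδhat : TendstoInMeasure ℙ δhat atTop (fun _ => δ))
    (hβhat : TendstoInMeasure ℙ βhat atTop (fun _ => β))
    (hvhat : TendstoInMeasure ℙ vhat atTop (fun _ => (0 : ℝ)))
    (hXbar : TendstoInMeasure ℙ Xbar atTop (fun _ => xbar₀))
    -- rescaled residuals and their empirical distribution function
    (ξhat : ℕ → ℕ → Ω → ℝ)
    (hξhat : ∀ i N ω, ξhat i N ω = (h (Z i ω) (δhat N ω))⁻¹
      * (W i ω + vhat N ω + ∑ j, (X i ω j - Xbar N ω j) * (β j - βhat N ω j)))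
    (Ghat : ℕ → Ω → ℝ → ℝ)
    (hGhat : ∀ N ω c, Ghat N ω c
      = (N : ℝ)⁻¹ * ∑ i ∈ Finset.range N, (if ξhat i N ω ≤ c then (1 : ℝ) else 0))
    -- the population function φ, jointly continuous, with φ(c; δ, 0, x̄₀, β) = G(c)
    (φ : ℝ × (Fin m → ℝ) × ℝ × (Fin p → ℝ) × (Fin p → ℝ) → ℝ)
    (hφdef : ∀ (c : ℝ) (a₁ : Fin m → ℝ) (a₂ : ℝ) (a₃ a₄ : Fin p → ℝ),
      φ (c, a₁, a₂, a₃, a₄)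
        = (ℙ {ω | (h (Z 0 ω) a₁)⁻¹
            * (W 0 ω + a₂ + ∑ j, (X 0 ω j - a₃ j) * (β j - a₄ j)) ≤ c}).toReal)
    (hφcont : Continuous φ)
    (hφG : ∀ c : ℝ, φ (c, δ, 0, xbar₀, β) = G c)
    -- uniform law of large numbers over compact parameter sets
    (hULLN : ∀ (K : Set ℝ) (Θ : Set ((Fin m → ℝ) × ℝ × (Fin p → ℝ) × (Fin p → ℝ))),
      IsCompact K → IsCompact Θ →
      TendstoInMeasure ℙ
        (fun (N : ℕ) (ω : Ω) => ⨆ x ∈ K ×ˢ Θ,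
          |(N : ℝ)⁻¹ * (∑ i ∈ Finset.range N,
              (if (h (Z i ω) x.2.1)⁻¹ * (W i ω + x.2.2.1
                  + ∑ j, (X i ω j - x.2.2.2.1 j) * (β j - x.2.2.2.2 j)) ≤ x.1
                then (1 : ℝ) else 0))
            - φ x|)
        atTop (fun _ => (0 : ℝ)))
    -- the single treated unit: fixed covariate value, standardized error with law ν
    (z₁ : Fin q → ℝ) (ξ0 : Ω → ℝ) (hξ0 : Measure.map ξ0 ℙ = ν)
    (W0 : Ω → ℝ) (hW0 : ∀ ω, W0 ω = h z₁ δ * ξ0 ω)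
    -- under the null, the centered DID statistic T_N satisfies T_N - W⁰ → 0 in prob.
    (T : ℕ → Ω → ℝ)
    (hT : TendstoInMeasure ℙ (fun (N : ℕ) (ω : Ω) => T N ω - W0 ω)
      atTop (fun _ => (0 : ℝ)))
    (τ : ℝ) (hτ : τ ∈ Set.Ioo (0 : ℝ) 1) :
    Tendsto (fun N : ℕ =>
        (ℙ {ω | Ghat N ω ((h z₁ (δhat N ω))⁻¹ * T N ω) ≤ τ / 2
            ∨ 1 - τ / 2 < Ghat N ω ((h z₁ (δhat N ω))⁻¹ * T N ω)}).toReal)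
      atTop (nhds τ) := by
  have hξ0m : AEMeasurable ξ0 (ℙ : Measure Ω) :=
    aemeasurable_of_map_neZero (by rw [hξ0]; infer_instance)
  have hR : TendstoInMeasure ℙ (fun N ω => (h z₁ (δhat N ω))⁻¹ * T N ω) atTop ξ0 := by
    have hcont : Continuous (fun y : (Fin m → ℝ) × ℝ × ℝ =>
        (h z₁ y.1)⁻¹ * (y.2.1 + h z₁ δ * y.2.2)) := by
      have hz : Continuous (fun y : (Fin m → ℝ) × ℝ × ℝ => h z₁ y.1) :=
        hhcont.comp (by fun_prop : Continuous fun y : (Fin m → ℝ) × ℝ × ℝ => (z₁, y.1))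
      exact (hz.inv₀ fun y => (hhpos _ _).ne').mul (by fun_prop)
    have hlim : TendstoInMeasure ℙ (fun N ω => (δhat N ω, T N ω - W0 ω, ξ0 ω)) atTop
        (fun ω => (δ, (0 : ℝ), ξ0 ω)) :=
      TendstoInMeasure.prodMk hδhat (TendstoInMeasure.prodMk hT (tendstoInMeasure_const ξ0))
    have hmeas : AEMeasurable (fun ω => (δ, (0 : ℝ), ξ0 ω)) (ℙ : Measure Ω) :=
      aemeasurable_const.prodMk (aemeasurable_const.prodMk hξ0m)
    have key := TendstoInMeasure.continuous_comp hlim hmeas hcont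
    convert key using 3 with N ω ω
    · simp [hW0]
    · rw [zero_add, inv_mul_cancel_left₀ (hhpos _ _).ne']
  set F : ℕ → Ω → (ℝ × (Fin m → ℝ) × ℝ × (Fin p → ℝ) × (Fin p → ℝ)) → ℝ := fun N ω x =>
    (N : ℝ)⁻¹ * (∑ i ∈ Finset.range N,
      (if (h (Z i ω) x.2.1)⁻¹ * (W i ω + x.2.2.1
          + ∑ j, (X i ω j - x.2.2.2.1 j) * (β j - x.2.2.2.2 j)) ≤ x.1
        then (1 : ℝ) else 0)) with hFdef
  have hFΦ : ∀ N ω x, |F N ω x - φ x| ≤ 1 := by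
    rintro N ω ⟨c, a₁, a₂, a₃, a₄⟩
    have hF := inv_mul_sum_ite_mem_Icc N (fun i => (h (Z i ω) a₁)⁻¹ * (W i ω + a₂
      + ∑ j, (X i ω j - a₃ j) * (β j - a₄ j)) ≤ c)
    have hφ0 : 0 ≤ φ (c, a₁, a₂, a₃, a₄) := hφdef c a₁ a₂ a₃ a₄ ▸ ENNReal.toReal_nonneg
    have hφ1 : φ (c, a₁, a₂, a₃, a₄) ≤ 1 := hφdef c a₁ a₂ a₃ a₄ ▸ measureReal_le_one
    have hF0 : 0 ≤ F N ω (c, a₁, a₂, a₃, a₄) := hF.1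
    have hF1 : F N ω (c, a₁, a₂, a₃, a₄) ≤ 1 := hF.2
    rw [abs_le]
    constructor <;> linarith
  have hFunif : ∀ C, IsCompact C → ∀ ε : ℝ, 0 < ε →
      Tendsto (fun N => (ℙ : Measure Ω) {ω | ∃ x ∈ C, ε ≤ |F N ω x - φ x|}) atTop (nhds 0) := by
    intro C hC ε hε
    have hsup := tendstoInMeasure_iff_dist.1 (hULLN _ _ (hC.image continuous_fst)
      (hC.image continuous_snd)) ε hε
    refine tendsto_of_tendsto_of_tendsto_of_le_of_le tendsto_const_nhds hsup
      (fun _ => zero_le) (fun N => measure_mono (μ := (ℙ : Measure Ω)) ?_)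
    rintro ω ⟨x, hx, hεx⟩
    have hxs : x ∈ (Prod.fst '' C) ×ˢ (Prod.snd '' C) :=
      Set.mk_mem_prod (Set.mem_image_of_mem _ hx) (Set.mem_image_of_mem _ hx)
    have hle := le_biSup_of_forall_le zero_le_one (hFΦ N ω) hxs
    rw [Set.mem_ofPred_eq, Real.dist_0_eq_abs]
    exact (hεx.trans hle).trans (le_abs_self _)
  have hlim : TendstoInMeasure ℙ
      (fun N ω => ((h z₁ (δhat N ω))⁻¹ * T N ω, δhat N ω, vhat N ω, Xbar N ω, βhat N ω)) atTop
      (fun ω => (ξ0 ω, δ, (0 : ℝ), xbar₀, β)) :=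
    TendstoInMeasure.prodMk hR (TendstoInMeasure.prodMk hδhat
      (TendstoInMeasure.prodMk hvhat (TendstoInMeasure.prodMk hXbar hβhat)))
  have hmeas : AEMeasurable (fun ω => (ξ0 ω, δ, (0 : ℝ), xbar₀, β)) (ℙ : Measure Ω) :=
    hξ0m.prodMk aemeasurable_const
  have hV := TendstoInMeasure.comp_of_uniform_on_compacts hφcont hFunif hlim hmeas
  simp only [hφG] at hV
  have hlevel := tendsto_measureReal_twoSided_of_tendstoInMeasure ν hG hGcont hξ0 hV hτ
  simpa only [hFdef, hGhat, hξhat, measureReal_def] using hlevel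
end

section
/- The second conservative test, which treats the N₁ treated units as a single aggregated unit of size M̃ = Σ_{j=1}^{N₁} M_j, is asymptotically level τ: if the test rejects if and only if P̂_N(T_N) ≤ τ/2 or P̂_N(T_N) > 1 − τ/2, where P̂_N(c) = N⁻¹ Σ_{i=1}^N 1{(Â_N + B̂_N/M̃)^{1/2} ξ̂_{i,N} ≤ c}, then limsup_{N → ∞} ℙ(reject) ≤ τ. -/
open MeasureTheory ProbabilityTheory Filter

open scoped Topology

/-- Joint continuous mapping theorem for convergence in measure to constants. -/
theorem tendstoInMeasure_comp_const₂ {Ω : Type*} [MeasurableSpace Ω] {μ : Measure Ω}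
    {X Y : ℕ → Ω → ℝ} {a b : ℝ} {h : ℝ × ℝ → ℝ} (hh : ContinuousAt h (a, b))
    (hX : TendstoInMeasure μ X atTop (fun _ => a))
    (hY : TendstoInMeasure μ Y atTop (fun _ => b)) :
    TendstoInMeasure μ (fun N ω => h (X N ω, Y N ω)) atTop (fun _ => h (a, b)) := by
  rw [tendstoInMeasure_iff_dist] at *
  intro ε hε
  obtain ⟨δ, hδ, H⟩ := Metric.continuousAt_iff.1 hh ε hε
  have hsum := (hX δ hδ).add (hY δ hδ)
  rw [add_zero] at hsum
  refine tendsto_of_tendsto_of_tendsto_of_le_of_le tendsto_const_nhds hsum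
    (fun _ => zero_le) fun N => ?_
  refine (measure_mono fun ω hω => ?_).trans (measure_union_le _ _)
  by_contra hcon
  simp only [Set.mem_union, Set.mem_ofPred_eq, not_or, not_le] at hcon hω
  exact absurd (H (x := (X N ω, Y N ω)) (by rw [Prod.dist_eq]; exact max_lt hcon.1 hcon.2))
    (not_lt.2 hω)

/-- A continuous strictly increasing cdf takes the value `q` at its `q`-quantile. -/
theorem cdf_quantile_eq (ν : Measure ℝ) [IsProbabilityMeasure ν] {G : ℝ → ℝ}
    (hG : ∀ c, G c = (ν (Set.Iic c)).toReal) (hGcont : Continuous G) (hGmono : StrictMono G)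
    {q : ℝ} (hq : q ∈ Set.Ioo (0 : ℝ) 1) : G (sInf {c : ℝ | q ≤ G c}) = q := by
  have hcdf : G = cdf ν := funext fun c => by rw [hG, cdf_eq_real, measureReal_def]
  have hbot : Tendsto G atBot (𝓝 0) := hcdf ▸ tendsto_cdf_atBot ν
  have htop : Tendsto G atTop (𝓝 1) := hcdf ▸ tendsto_cdf_atTop ν
  obtain ⟨a, ha⟩ := (hbot.eventually_lt_const hq.1).exists
  obtain ⟨b, hb⟩ := (htop.eventually_const_lt hq.2).exists
  obtain ⟨c, hc⟩ := mem_range_of_exists_le_of_exists_ge hGcont ⟨a, ha.le⟩ ⟨b, hb.le⟩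
  have hset : {x : ℝ | q ≤ G x} = Set.Ici c := by
    ext x
    rw [Set.mem_ofPred_eq, ← hc, hGmono.le_iff_le, Set.mem_Ici]
  rw [hset, csInf_Ici, hc]

/-- Right continuity of the distribution function of a random variable. -/
theorem exists_pos_measureReal_le_add {Ω : Type*} [MeasurableSpace Ω] (μ : Measure Ω)
    [IsProbabilityMeasure μ] {X : Ω → ℝ} (hX : AEMeasurable X μ) (c : ℝ) {η : ℝ} (hη : 0 < η) :
    ∃ ε > 0, μ.real {ω | X ω ≤ c + ε} ≤ μ.real {ω | X ω ≤ c} + η := by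
  have := Measure.isProbabilityMeasure_map hX
  have key : ∀ x, cdf (μ.map X) x = μ.real {ω | X ω ≤ x} := fun x => by
    rw [cdf_eq_real, measureReal_def, Measure.map_apply_of_aemeasurable hX measurableSet_Iic]
    rfl
  have hcont : Tendsto (cdf (μ.map X)) (𝓝[>] c) (𝓝 (cdf (μ.map X) c)) :=
    (((cdf (μ.map X)).right_continuous c).mono Set.Ioi_subset_Ici_self)
  have hev := hcont.eventually_lt_const (lt_add_of_pos_right _ hη)
  obtain ⟨x, hx, hcx⟩ := (hev.and self_mem_nhdsWithin).exists
  refine ⟨x - c, sub_pos.2 hcx, ?_⟩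
  rw [add_sub_cancel, ← key, ← key]
  exact hx.le

/-- Events that are asymptotically contained in `{X ≤ c + ε}` for every `ε > 0` have
asymptotic probability at most that of `{X ≤ c}`. -/
theorem eventually_measureReal_le_add {Ω : Type*} [MeasurableSpace Ω] (μ : Measure Ω)
    [IsProbabilityMeasure μ] {X : Ω → ℝ} (hX : AEMeasurable X μ) (c : ℝ) {R : ℕ → Set Ω}
    (hR : ∀ ε > 0, Tendsto (fun N => μ (R N \ {ω | X ω ≤ c + ε})) atTop (𝓝 0))
    {η : ℝ} (hη : 0 < η) :
    ∀ᶠ N in atTop, μ.real (R N) ≤ μ.real {ω | X ω ≤ c} + η := by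
  obtain ⟨ε, hε, hle⟩ := exists_pos_measureReal_le_add μ hX c (half_pos hη)
  have hreal : Tendsto (fun N => μ.real (R N \ {ω | X ω ≤ c + ε})) atTop (𝓝 0) := by
    simpa [measureReal_def, Function.comp_def] using
      (ENNReal.tendsto_toReal ENNReal.zero_ne_top).comp (hR ε hε)
  filter_upwards [hreal.eventually_lt_const (half_pos hη)] with N hN
  have hsub : R N ⊆ {ω | X ω ≤ c + ε} ∪ (R N \ {ω | X ω ≤ c + ε}) := by
    rw [Set.union_sdiff_self]
    exact Set.subset_union_right
  have := (measureReal_mono (μ := μ) hsub).trans (measureReal_union_le _ _)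
  linarith

/-- An empirical average of indicators is monotone under pointwise implication. -/
theorem average_indicator_mono {N : ℕ} {p r : ℕ → Prop} [DecidablePred p] [DecidablePred r]
    (h : ∀ i, p i → r i) :
    (N : ℝ)⁻¹ * ∑ i ∈ Finset.range N, (if p i then (1 : ℝ) else 0)
      ≤ (N : ℝ)⁻¹ * ∑ i ∈ Finset.range N, (if r i then (1 : ℝ) else 0) := by
  refine mul_le_mul_of_nonneg_left (Finset.sum_le_sum fun i _ => ?_) (by positivity)
  by_cases hp : p i
  · rw [if_pos hp, if_pos (h i hp)]
  · rw [if_neg hp]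
    split_ifs <;> norm_num

theorem biSup_singleton_of_nonneg {f : ℝ → ℝ} (hf : ∀ x, 0 ≤ f x) (y : ℝ) :
    ⨆ c ∈ ({y} : Set ℝ), f c = f y := by
  have hle : ∀ c, ⨆ _ : c ∈ ({y} : Set ℝ), f c ≤ f y := fun c =>
    Real.iSup_le (fun hc => (congrArg f hc).le) (hf y)
  refine le_antisymm (Real.iSup_le hle (hf y)) ?_
  refine le_ciSup_of_le ⟨f y, Set.forall_mem_range.2 hle⟩ y ?_
  simp

/-- Proposition 5 (Ferman 2021): the second conservative test, which treats the N₁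
treated units as a single aggregated unit of size M̃ = Σⱼ Mⱼ, is asymptotically
level τ under the regularity condition (Assumption 6). -/
theorem conservative_test_two_asymptotically_level
    {Ω : Type*} [MeasureSpace Ω] [IsProbabilityMeasure (ℙ : Measure Ω)]
    (ν : Measure ℝ) [IsProbabilityMeasure ν]
    (G : ℝ → ℝ) (hG : ∀ c, G c = (ν (Set.Iic c)).toReal)
    (hGcont : Continuous G) (hGmono : StrictMono G)
    (hmean : ∫ x, x ∂ν = 0)
    (hmom2 : ∫⁻ x, ENNReal.ofReal (x ^ 2) ∂ν < ⊤)
    -- quantiles of ν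
    (gq : ℝ → ℝ) (hgq : ∀ q' : ℝ, gq q' = sInf {c : ℝ | q' ≤ G c})
    -- variance components and control-unit sizes
    (A B : ℝ) (hA : 0 ≤ A) (hB : 0 ≤ B) (hAB : 0 < A + B)
    (M : ℕ → ℝ) (hM : ∀ i, 0 < M i)
    -- control-unit standardized errors and errors
    (ξ : ℕ → Ω → ℝ) (hξ : ∀ i, Measure.map (ξ i) ℙ = ν)
    (W : ℕ → Ω → ℝ) (hWdef : ∀ i ω, W i ω = Real.sqrt (A + B / M i) * ξ i ω)
    -- consistent estimators of A and B
    (Ahat Bhat : ℕ → Ω → ℝ)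
    (hAhat : TendstoInMeasure ℙ Ahat atTop (fun _ => A))
    (hBhat : TendstoInMeasure ℙ Bhat atTop (fun _ => B))
    -- residuals and rescaled residuals of the control units
    (What : ℕ → ℕ → Ω → ℝ)
    (ξhat : ℕ → ℕ → Ω → ℝ)
    (hξhat : ∀ i N ω, ξhat i N ω
      = (Real.sqrt (Ahat N ω + Bhat N ω / M i))⁻¹ * What i N ω)
    -- the residuals satisfy the conditions of the heteroskedastic convergence result,
    -- so that the rescaled empirical cdf converges uniformly on compacts to G
    (Ghat : ℕ → Ω → ℝ → ℝ)
    (hGhat : ∀ N ω c, Ghat N ω c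
      = (N : ℝ)⁻¹ * ∑ i ∈ Finset.range N, (if ξhat i N ω ≤ c then (1 : ℝ) else 0))
    (hGhatconv : ∀ K : Set ℝ, IsCompact K →
      TendstoInMeasure ℙ (fun (N : ℕ) (ω : Ω) => ⨆ c ∈ K, |Ghat N ω c - G c|)
        atTop (fun _ => (0 : ℝ)))
    -- treated units: sizes, standardized errors, weighted-average error
    (N₁ : ℕ) (hN₁ : 0 < N₁) (Mt : Fin N₁ → ℝ) (hMt : ∀ j, 0 < Mt j)
    (Mtilde : ℝ) (hMtilde : Mtilde = ∑ j, Mt j)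
    (ξt : Fin N₁ → Ω → ℝ) (hξt : ∀ j, Measure.map (ξt j) ℙ = ν)
    (Wtilde : Ω → ℝ)
    (hWtilde : ∀ ω, Wtilde ω
      = ∑ j, (Mt j / Mtilde) * (Real.sqrt (A + B / Mt j) * ξt j ω))
    (τ : ℝ) (hτ : τ ∈ Set.Ioo (0 : ℝ) 1)
    -- critical values for the aggregated unit
    (cq : ℝ → ℝ) (hcq : ∀ q', cq q' = Real.sqrt (A + B / Mtilde) * gq q')
    -- the law of W̃ assigns zero mass to the two critical values
    (hnoatom1 : ℙ {ω | Wtilde ω = cq (τ / 2)} = 0)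
    (hnoatom2 : ℙ {ω | Wtilde ω = cq (1 - τ / 2)} = 0)
    -- regularity condition
    (hreg : (ℙ {ω | Wtilde ω ≤ cq (τ / 2)}).toReal
        + (ℙ {ω | cq (1 - τ / 2) < Wtilde ω}).toReal ≤ τ)
    -- under the null, the centered weighted DID statistic satisfies T_N - W̃ → 0
    (T : ℕ → Ω → ℝ)
    (hT : TendstoInMeasure ℙ (fun (N : ℕ) (ω : Ω) => T N ω - Wtilde ω)
      atTop (fun _ => (0 : ℝ)))
    -- the rescaled empirical cdf used by the test
    (Phat : ℕ → Ω → ℝ → ℝ)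
    (hPhat : ∀ N ω c, Phat N ω c
      = (N : ℝ)⁻¹ * ∑ i ∈ Finset.range N,
          (if Real.sqrt (Ahat N ω + Bhat N ω / Mtilde) * ξhat i N ω ≤ c
            then (1 : ℝ) else 0)) :
    limsup (fun N : ℕ =>
        (ℙ {ω | Phat N ω (T N ω) ≤ τ / 2 ∨ 1 - τ / 2 < Phat N ω (T N ω)}).toReal)
      atTop ≤ τ := by
  have hMtpos : 0 < Mtilde := by
    rw [hMtilde]
    exact Finset.sum_pos (fun j _ => hMt j) ⟨⟨0, hN₁⟩, Finset.mem_univ _⟩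
  have hvar : 0 < A + B / Mtilde := by
    rcases hA.eq_or_lt with rfl | hApos
    · have : 0 < B := by linarith
      positivity
    · positivity
  set s := Real.sqrt (A + B / Mtilde) with hs
  have hspos : 0 < s := Real.sqrt_pos.2 hvar
  set S : ℕ → Ω → ℝ := fun N ω => Real.sqrt (Ahat N ω + Bhat N ω / Mtilde) with hS
  have hSy : ∀ y, TendstoInMeasure ℙ (fun N ω => S N ω * y) atTop (fun _ => s * y) := fun y =>
    tendstoInMeasure_comp_const₂ (h := fun p : ℝ × ℝ => Real.sqrt (p.1 + p.2 / Mtilde) * y)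
      (by fun_prop) hAhat hBhat
  have hWm : AEMeasurable Wtilde ℙ := by
    have hξm : ∀ j, AEMeasurable (ξt j) ℙ := fun j => by
      refine AEMeasurable.of_map_ne_zero ?_
      rw [hξt j]
      exact IsProbabilityMeasure.ne_zero ν
    rw [funext hWtilde]
    exact Finset.aemeasurable_fun_sum _ fun j _ => ((hξm j).const_mul _).const_mul _
  have hGpt : ∀ y, TendstoInMeasure ℙ (fun N ω => Ghat N ω y) atTop (fun _ => G y) := by
    intro y
    have hK := hGhatconv {y} isCompact_singleton
    simp only [biSup_singleton_of_nonneg (fun _ => abs_nonneg _)] at hK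
    simpa [tendstoInMeasure_iff_dist, Real.dist_eq] using hK
  have hqlo : τ / 2 ∈ Set.Ioo (0 : ℝ) 1 := ⟨by linarith [hτ.1], by linarith [hτ.2]⟩
  have hqhi : 1 - τ / 2 ∈ Set.Ioo (0 : ℝ) 1 := ⟨by linarith [hτ.2], by linarith [hτ.1]⟩
  have hGq : ∀ q ∈ Set.Ioo (0 : ℝ) 1, G (gq q) = q := fun q hq => by
    rw [hgq, cdf_quantile_eq ν hG hGcont hGmono hq]
  have hbad : ∀ ε > 0, ∀ y, ∀ η > 0, Tendsto (fun N =>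
      ℙ {ω | ε ≤ |T N ω - Wtilde ω|} + ℙ {ω | ε ≤ |S N ω * y - s * y|}
        + ℙ {ω | s ≤ |S N ω - s|} + ℙ {ω | η ≤ |Ghat N ω y - G y|}) atTop (𝓝 0) := by
    intro ε hε y η hη
    have h1 := tendstoInMeasure_iff_dist.1 hT ε hε
    have h2 := tendstoInMeasure_iff_dist.1 (hSy y) ε hε
    have h3 := tendstoInMeasure_iff_dist.1 (hSy 1) s hspos
    have h4 := tendstoInMeasure_iff_dist.1 (hGpt y) η hη
    simpa [Real.dist_eq] using ((h1.add h2).add h3).add h4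
  have hcover : ∀ ε y η, ∀ R : ℕ → Set Ω, (∀ N, ∀ ω ∈ R N,
      |T N ω - Wtilde ω| < ε → |S N ω * y - s * y| < ε → |S N ω - s| < s →
        η ≤ |Ghat N ω y - G y|) → 0 < ε → 0 < η →
      Tendsto (fun N => ℙ (R N)) atTop (𝓝 0) := by
    intro ε y η R hR hε hη
    refine tendsto_of_tendsto_of_tendsto_of_le_of_le tendsto_const_nhds (hbad ε hε y η hη)
      (fun _ => zero_le) fun N => ?_
    have hsub : R N ⊆ {ω | ε ≤ |T N ω - Wtilde ω|} ∪ {ω | ε ≤ |S N ω * y - s * y|}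
        ∪ {ω | s ≤ |S N ω - s|} ∪ {ω | η ≤ |Ghat N ω y - G y|} := by
      intro ω hω
      by_contra hcon
      simp only [Set.mem_union, Set.mem_ofPred_eq, not_or, not_le] at hcon
      exact absurd (hR N ω hω hcon.1.1.1 hcon.1.1.2 hcon.1.2) (not_le.2 hcon.2)
    refine (measure_mono hsub).trans ((measure_union_le _ _).trans ?_)
    gcongr
    refine (measure_union_le _ _).trans ?_
    gcongr
    exact measure_union_le _ _
  have hlo : ∀ ε > 0, Tendsto (fun N => ℙ ({ω | Phat N ω (T N ω) ≤ τ / 2} \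
      {ω | Wtilde ω ≤ cq (τ / 2) + ε})) atTop (𝓝 0) := by
    intro ε hε
    have hy : gq (τ / 2) < gq (τ / 2) + ε / 3 / s := lt_add_of_pos_right _ (by positivity)
    have hsy : s * (gq (τ / 2) + ε / 3 / s) = cq (τ / 2) + ε / 3 := by
      rw [hcq, mul_add, mul_div_cancel₀ _ hspos.ne']
    have hGy := hGmono hy
    rw [hGq _ hqlo] at hGy
    refine hcover (ε / 3) (gq (τ / 2) + ε / 3 / s) _ _ ?_ (by positivity) (sub_pos.2 hGy)
    rintro N ω ⟨hP, hW⟩ h1 h2 -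
    simp only [Set.mem_ofPred_eq, not_le] at hP hW
    rw [abs_lt] at h1 h2
    have hle : Ghat N ω (gq (τ / 2) + ε / 3 / s) ≤ Phat N ω (T N ω) := by
      rw [hGhat, hPhat]
      refine average_indicator_mono fun i hi => ?_
      have := mul_le_mul_of_nonneg_left hi (Real.sqrt_nonneg (Ahat N ω + Bhat N ω / Mtilde))
      simp only [hS] at h2
      linarith
    rw [abs_sub_comm]
    exact (by linarith : _ ≤ _).trans (le_abs_self _)
  have hhi : ∀ ε > 0, Tendsto (fun N => ℙ ({ω | 1 - τ / 2 < Phat N ω (T N ω)} \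
      {ω | -Wtilde ω ≤ -cq (1 - τ / 2) + ε})) atTop (𝓝 0) := by
    intro ε hε
    have hy : gq (1 - τ / 2) - ε / 3 / s < gq (1 - τ / 2) := sub_lt_self _ (by positivity)
    have hsy : s * (gq (1 - τ / 2) - ε / 3 / s) = cq (1 - τ / 2) - ε / 3 := by
      rw [hcq, mul_sub, mul_div_cancel₀ _ hspos.ne']
    have hGy := hGmono hy
    rw [hGq _ hqhi] at hGy
    refine hcover (ε / 3) (gq (1 - τ / 2) - ε / 3 / s) _ _ ?_ (by positivity) (sub_pos.2 hGy)
    rintro N ω ⟨hP, hW⟩ h1 h2 h3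
    simp only [Set.mem_ofPred_eq, not_le] at hP hW
    rw [abs_lt] at h1 h2 h3
    have hSpos : 0 < S N ω := by linarith
    have hle : Phat N ω (T N ω) ≤ Ghat N ω (gq (1 - τ / 2) - ε / 3 / s) := by
      rw [hGhat, hPhat]
      refine average_indicator_mono fun i hi => ?_
      refine le_of_mul_le_mul_left ?_ hSpos
      simp only [hS] at h2 ⊢
      linarith
    exact (by linarith : _ ≤ _).trans (le_abs_self _)
  have htail : (ℙ : Measure Ω).real {ω | -Wtilde ω ≤ -cq (1 - τ / 2)}
      ≤ (ℙ {ω | cq (1 - τ / 2) < Wtilde ω}).toReal := by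
    refine ENNReal.toReal_mono (measure_ne_top _ _) ?_
    have hsub : {ω | -Wtilde ω ≤ -cq (1 - τ / 2)}
        ⊆ {ω | cq (1 - τ / 2) < Wtilde ω} ∪ {ω | Wtilde ω = cq (1 - τ / 2)} := by
      intro ω hω
      rcases (neg_le_neg_iff.1 (Set.mem_ofPred_eq ▸ hω)).lt_or_eq with h | h
      · exact Or.inl h
      · exact Or.inr h.symm
    refine (measure_mono hsub).trans ((measure_union_le _ _).trans ?_)
    rw [hnoatom2, add_zero]
  refine le_of_forall_pos_le_add fun η hη => ?_
  refine limsup_le_of_le ?_ ?_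
  · exact isCoboundedUnder_le_of_le atTop (x := 0) fun _ => ENNReal.toReal_nonneg
  filter_upwards [eventually_measureReal_le_add ℙ hWm _ hlo (half_pos hη),
    eventually_measureReal_le_add ℙ hWm.neg _ hhi (half_pos hη)] with N h1 h2
  have h3 := measureReal_union_le (μ := (ℙ : Measure Ω)) {ω | Phat N ω (T N ω) ≤ τ / 2}
    {ω | 1 - τ / 2 < Phat N ω (T N ω)}
  rw [← Set.ofPred_or] at h3
  simp only [measureReal_def, Pi.neg_apply] at h1 h2 h3 htail
  linarith
end

section
/- Let σ > 0 and τ ∈ (0,1), and let c₁, c₂ ∈ ℝ be the τ/2- and (1−τ/2)-quantiles of the centered Gaussian distribution N(0, σ²), i.e. Φ_{0,σ²}(c₁) = τ/2 and Φ_{0,σ²}(c₂) = 1 − τ/2, where Φ_{0,σ²} is the cdf of N(0, σ²). If Y is a real random variable whose law is Gaussian N(0, v) with 0 ≤ v ≤ σ², then ℙ(Y ≤ c₁) + ℙ(Y > c₂) ≤ τ. In particular, the regularity condition (Assumption 2) is satisfied whenever the treated units' errors are jointly Gaussian with common marginal N(0, σ²), since their average is then N(0, v) with v ≤ σ². -/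
open MeasureTheory ProbabilityTheory Filter

/-- A centered Gaussian measure is invariant under reflection. -/
lemma gaussianReal_zero_real_preimage_neg (w : NNReal) {s : Set ℝ} (hs : MeasurableSet s) :
    (gaussianReal 0 w).real ((fun x ↦ -x) ⁻¹' s) = (gaussianReal 0 w).real s := by
  rw [← map_measureReal_apply measurable_neg hs, gaussianReal_map_neg, neg_zero]

lemma half_le_gaussianReal_zero_real_Iic_zero (w : NNReal) :
    1 / 2 ≤ (gaussianReal 0 w).real (Set.Iic 0) := by
  have hsymm := gaussianReal_zero_real_preimage_neg w (measurableSet_Iic (a := (0 : ℝ)))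
  have hcover : (Set.univ : Set ℝ) ⊆ Set.Iic 0 ∪ (fun x ↦ -x) ⁻¹' Set.Iic 0 := by
    intro x _
    simp
  have hle := (measureReal_mono (μ := gaussianReal 0 w) hcover).trans (measureReal_union_le _ _)
  rw [probReal_univ] at hle
  linarith

lemma gaussianReal_zero_real_Iio_zero_le_half (w : NNReal) :
    (gaussianReal 0 w).real (Set.Iio 0) ≤ 1 / 2 := by
  have hcompl := probReal_compl_eq_one_sub (μ := gaussianReal 0 w)
    (measurableSet_Iic (a := (0 : ℝ)))
  have hsymm := gaussianReal_zero_real_preimage_neg w (measurableSet_Iio (a := (0 : ℝ)))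
  have hset : (fun x : ℝ ↦ -x) ⁻¹' Set.Iio 0 = (Set.Iic 0)ᶜ := by
    ext x
    simp
  rw [hset] at hsymm
  linarith [half_le_gaussianReal_zero_real_Iic_zero w]

/-- A centered Gaussian measure is a contraction of any centered Gaussian measure with
larger variance. -/
lemma exists_gaussianReal_zero_eq_map_const_mul {v w : NNReal} (h : v ≤ w) :
    ∃ t : ℝ, 0 ≤ t ∧ t ≤ 1 ∧ gaussianReal 0 v = (gaussianReal 0 w).map (t * ·) := by
  have hle : (v / w : NNReal) ≤ 1 := div_le_one_of_le₀ h w.2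
  refine ⟨√((v / w : NNReal) : ℝ), Real.sqrt_nonneg _,
    Real.sqrt_le_one.2 (by exact_mod_cast hle), ?_⟩
  rw [gaussianReal_map_const_mul, mul_zero]
  congr 1
  ext
  rw [NNReal.coe_mul, NNReal.coe_mk, Real.sq_sqrt (NNReal.coe_nonneg _), NNReal.coe_div]
  rcases eq_or_ne w 0 with rfl | hw
  · simpa using h
  · exact (div_mul_cancel₀ _ (NNReal.coe_ne_zero.2 hw)).symm

lemma gaussianReal_zero_real_Iic_mono {v w : NNReal} (h : v ≤ w) {c : ℝ} (hc : c < 0) :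
    (gaussianReal 0 v).real (Set.Iic c) ≤ (gaussianReal 0 w).real (Set.Iic c) := by
  obtain ⟨t, ht0, ht1, hmap⟩ := exists_gaussianReal_zero_eq_map_const_mul h
  rw [hmap, map_measureReal_apply (measurable_const_mul t) measurableSet_Iic]
  refine measureReal_mono fun x hx ↦ ?_
  simp only [Set.mem_preimage, Set.mem_Iic] at hx ⊢
  have hx_neg : x < 0 := neg_of_mul_neg_right (hx.trans_lt hc) ht0
  nlinarith

lemma gaussianReal_zero_real_Ioi_mono {v w : NNReal} (h : v ≤ w) {c : ℝ} (hc : 0 ≤ c) :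
    (gaussianReal 0 v).real (Set.Ioi c) ≤ (gaussianReal 0 w).real (Set.Ioi c) := by
  obtain ⟨t, ht0, ht1, hmap⟩ := exists_gaussianReal_zero_eq_map_const_mul h
  rw [hmap, map_measureReal_apply (measurable_const_mul t) measurableSet_Ioi]
  refine measureReal_mono fun x hx ↦ ?_
  simp only [Set.mem_preimage, Set.mem_Ioi] at hx ⊢
  by_contra! hle
  nlinarith

/-- The regularity condition (Assumption 2) holds in the Gaussian case: if c₁, c₂ are
the τ/2- and (1−τ/2)-quantiles of N(0, σ²) and Y is N(0, v) with v ≤ σ², then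
ℙ(Y ≤ c₁) + ℙ(Y > c₂) ≤ τ. -/
theorem gaussian_regularity_condition
    {Ω : Type*} [MeasureSpace Ω] [IsProbabilityMeasure (ℙ : Measure Ω)]
    (σ : ℝ) (hσ : 0 < σ) (τ : ℝ) (hτ : τ ∈ Set.Ioo (0 : ℝ) 1)
    (c₁ c₂ : ℝ)
    (hc₁ : ((gaussianReal 0 ⟨σ ^ 2, sq_nonneg σ⟩) (Set.Iic c₁)).toReal = τ / 2)
    (hc₂ : ((gaussianReal 0 ⟨σ ^ 2, sq_nonneg σ⟩) (Set.Iic c₂)).toReal = 1 - τ / 2)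
    (v : NNReal) (hv : (v : ℝ) ≤ σ ^ 2)
    (Y : Ω → ℝ) (hY : Measure.map Y ℙ = gaussianReal 0 v) :
    (ℙ {ω | Y ω ≤ c₁}).toReal + (ℙ {ω | c₂ < Y ω}).toReal ≤ τ := by
  set w : NNReal := ⟨σ ^ 2, sq_nonneg σ⟩
  change (gaussianReal 0 w).real (Set.Iic c₁) = τ / 2 at hc₁
  change (gaussianReal 0 w).real (Set.Iic c₂) = 1 - τ / 2 at hc₂
  have hvw : v ≤ w := hv
  have hY_meas : AEMeasurable Y ℙ :=
    AEMeasurable.of_map_ne_zero (hY ▸ IsProbabilityMeasure.ne_zero _)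
  have hc₁_neg : c₁ < 0 := by
    by_contra! h
    have := measureReal_mono (μ := gaussianReal 0 w) (Set.Iic_subset_Iic.2 h)
    linarith [half_le_gaussianReal_zero_real_Iic_zero w, hτ.2]
  have hc₂_nonneg : 0 ≤ c₂ := by
    by_contra! h
    have := measureReal_mono (μ := gaussianReal 0 w) (Set.Iic_subset_Iio.2 h)
    linarith [gaussianReal_zero_real_Iio_zero_le_half w, hτ.2]
  have hlower : (ℙ {ω | Y ω ≤ c₁}).toReal = (gaussianReal 0 v).real (Set.Iic c₁) := by
    rw [← hY, map_measureReal_apply_of_aemeasurable hY_meas measurableSet_Iic]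
    rfl
  have hupper : (ℙ {ω | c₂ < Y ω}).toReal = (gaussianReal 0 v).real (Set.Ioi c₂) := by
    rw [← hY, map_measureReal_apply_of_aemeasurable hY_meas measurableSet_Ioi]
    rfl
  have htail := probReal_compl_eq_one_sub (μ := gaussianReal 0 w)
    (measurableSet_Iic (a := c₂))
  rw [Set.compl_Iic] at htail
  rw [hlower, hupper]
  linarith [gaussianReal_zero_real_Iic_mono hvw hc₁_neg,
    gaussianReal_zero_real_Ioi_mono hvw hc₂_nonneg]
end

section
/- For all real A, B ≥ 0 and M₁, M₂ > 0, writing w₁ = M₁/(M₁+M₂) and w₂ = M₂/(M₁+M₂), the three asymptotic variances satisfy the chain σ²_cons1 ≥ σ²_cons2 ≥ σ²_naive, i.e. (w₁ √(A + B/M₁) + w₂ √(A + B/M₂))² ≥ A + B/(M₁+M₂) ≥ w₁² (A + B/M₁) + w₂² (A + B/M₂). Moreover, if A = 0 then the second inequality holds with equality: B/(M₁+M₂) = w₁² (B/M₁) + w₂² (B/M₂). -/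
/-- For size-proportional weights, the variance under independence falls short of the variance of
the pooled unit by the cross term `2 w₁ w₂ A`. -/
theorem weighted_variance_add_cross_term (A B : ℝ) {M₁ M₂ : ℝ} (hM₁ : 0 < M₁) (hM₂ : 0 < M₂) :
    (M₁ / (M₁ + M₂)) ^ 2 * (A + B / M₁) + (M₂ / (M₁ + M₂)) ^ 2 * (A + B / M₂)
        + 2 * (M₁ / (M₁ + M₂) * (M₂ / (M₁ + M₂))) * A
      = A + B / (M₁ + M₂) := by
  have hM : M₁ + M₂ ≠ 0 := by positivity
  field_simp
  ring


/-- Comparison of the three asymptotic variances in Section 4 (Ferman 2021):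
σ²_cons1 ≥ σ²_cons2 ≥ σ²_naive, with equality in the second when A = 0. -/
theorem variance_chain_cons1_cons2_naive
    (A B M₁ M₂ : ℝ) (hA : 0 ≤ A) (hB : 0 ≤ B) (hM₁ : 0 < M₁) (hM₂ : 0 < M₂) :
    (M₁ / (M₁ + M₂) * Real.sqrt (A + B / M₁)
        + M₂ / (M₁ + M₂) * Real.sqrt (A + B / M₂)) ^ 2
      ≥ A + B / (M₁ + M₂)
    ∧ A + B / (M₁ + M₂)
      ≥ (M₁ / (M₁ + M₂)) ^ 2 * (A + B / M₁) + (M₂ / (M₁ + M₂)) ^ 2 * (A + B / M₂)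
    ∧ (A = 0 → B / (M₁ + M₂)
        = (M₁ / (M₁ + M₂)) ^ 2 * (B / M₁) + (M₂ / (M₁ + M₂)) ^ 2 * (B / M₂)) := by
  have hw : 0 ≤ M₁ / (M₁ + M₂) * (M₂ / (M₁ + M₂)) := by positivity
  have key := weighted_variance_add_cross_term A B hM₁ hM₂
  refine ⟨?_, ?_, ?_⟩
  · have hb₁ : 0 ≤ B / M₁ := by positivity
    have hb₂ : 0 ≤ B / M₂ := by positivity
    have hs : A ≤ √(A + B / M₁) * √(A + B / M₂) :=
      calc A = √A * √A := (Real.mul_self_sqrt hA).symm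
        _ ≤ √(A + B / M₁) * √(A + B / M₂) := by gcongr <;> linarith
    rw [ge_iff_le, ← key, add_sq, mul_pow, mul_pow, Real.sq_sqrt (by positivity),
      Real.sq_sqrt (by positivity)]
    linarith [mul_le_mul_of_nonneg_left hs hw]
  · linarith [mul_nonneg hw hA]
  · rintro rfl
    simpa using key.symm
end
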